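/- Let x : (0,∞)^n → (0,∞)^n be a demand system satisfying gross substitutes (for each good j, x_j(p) is nondecreasing in p_k for every k ≠ j) and homogeneity of degree −1 (x(λp) = λ⁻¹·x(p) for all λ > 0), and let P : (0,∞)^n → (0,∞)^n be an equilibrium-price map, i.e. x(P(w)) = w for every supply vector w ∈ (0,∞)^n. Then for all supply vectors w, w' ∈ (0,∞)^n: max_{j} |ln P(w')_j − ln P(w)_j| ≤ Σ_{i=1}^n |ln w'_i − ln w_i|; that is, the maximal change in any equilibrium log-price is bounded by the ℓ¹-distance between the log-supply vectors. -/

import Mathlib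

open Finset

/-- Gross substitutes: raising all other prices weakly raises demand. -/
theorem gs_mono (n : ℕ) (x : (Fin n → ℝ) → (Fin n → ℝ))
    (hgs : ∀ p : Fin n → ℝ, (∀ j, 0 < p j) → ∀ k j : Fin n, j ≠ k →
      ∀ a b : ℝ, 0 < a → a ≤ b →
        x (Function.update p k a) j ≤ x (Function.update p k b) j)
    (q r : Fin n → ℝ) (hq : ∀ i, 0 < q i) (hqr : ∀ i, q i ≤ r i)
    (j : Fin n) (hj : q j = r j) : x q j ≤ x r j := by
  have key : ∀ s : Finset (Fin n), x q j ≤ x (s.piecewise r q) j := by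
    intro s
    induction s using Finset.induction_on with
    | empty => simp
    | insert k s hk ih =>
      refine ih.trans ?_
      rw [Finset.piecewise_insert]
      have hself : Function.update (s.piecewise r q) k (q k) = s.piecewise r q := by
        rw [Function.update_eq_self_iff, Finset.piecewise_eq_of_notMem _ _ _ hk]
      by_cases hjk : j = k
      · subst hjk
        rw [← hj, hself]
      · have h := hgs (s.piecewise r q) (fun i => by
          by_cases hi : i ∈ s
          · simpa [hi] using (hq i).trans_le (hqr i)
          · simpa [hi] using hq i) k j hjk (q k) (r k) (hq k) (hqr k)
        rwa [hself] at h
  simpa using key Finset.univ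

/-- One-sided bound. -/
theorem one_sided (n : ℕ) (x : (Fin n → ℝ) → (Fin n → ℝ))
    (hpos : ∀ p : Fin n → ℝ, (∀ j, 0 < p j) → ∀ j, 0 < x p j)
    (hgs : ∀ p : Fin n → ℝ, (∀ j, 0 < p j) → ∀ k j : Fin n, j ≠ k →
      ∀ a b : ℝ, 0 < a → a ≤ b →
        x (Function.update p k a) j ≤ x (Function.update p k b) j)
    (hhom : ∀ lam : ℝ, 0 < lam → ∀ p : Fin n → ℝ, (∀ j, 0 < p j) →
      x (lam • p) = lam⁻¹ • x p)
    (p q : Fin n → ℝ) (hp : ∀ i, 0 < p i) (hq : ∀ i, 0 < q i) (j : Fin n) :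
    Real.log (q j) - Real.log (p j) ≤
      ∑ i, |Real.log (x q i) - Real.log (x p i)| := by
  have : Nonempty (Fin n) := ⟨j⟩
  obtain ⟨m, hm⟩ := Finite.exists_max (fun i => q i / p i)
  have hl : 0 < q m / p m := div_pos (hq m) (hp m)
  have h1 := gs_mono n x hgs q ((q m / p m) • p) hq
    (fun i => by
      have := hm i
      rw [div_le_iff₀ (hp i)] at this
      simpa using this) m (by
      have := (hp m).ne'
      simp [this])
  rw [hhom _ hl p hp] at h1
  have h2 := Real.log_le_log (hpos q hq m) h1
  simp only [Pi.smul_apply, smul_eq_mul] at h2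
  rw [Real.log_mul (inv_pos.2 hl).ne' (hpos p hp m).ne', Real.log_inv] at h2
  have h3 := Real.log_le_log (div_pos (hq j) (hp j)) (hm j)
  rw [Real.log_div (hq j).ne' (hp j).ne'] at h3
  have h4 := Finset.single_le_sum
    (f := fun i => |Real.log (x q i) - Real.log (x p i)|)
    (fun i _ => abs_nonneg _) (Finset.mem_univ m)
  have h5 := neg_abs_le (Real.log (x q m) - Real.log (x p m))
  linarith

/-- The maximal change in any equilibrium log-price is bounded
by the ℓ¹-distance between the log-supply vectors. -/
theorem equilibrium_log_price_stability
    (n : ℕ) (x : (Fin n → ℝ) → (Fin n → ℝ))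
    (hpos : ∀ p : Fin n → ℝ, (∀ j, 0 < p j) → ∀ j, 0 < x p j)
    -- gross substitutes: x_j is nondecreasing in p_k for every k ≠ j
    (hgs : ∀ p : Fin n → ℝ, (∀ j, 0 < p j) → ∀ k j : Fin n, j ≠ k →
      ∀ a b : ℝ, 0 < a → a ≤ b →
        x (Function.update p k a) j ≤ x (Function.update p k b) j)
    -- homogeneity of degree -1
    (hhom : ∀ lam : ℝ, 0 < lam → ∀ p : Fin n → ℝ, (∀ j, 0 < p j) →
      x (lam • p) = lam⁻¹ • x p)
    -- equilibrium-price map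
    (P : (Fin n → ℝ) → (Fin n → ℝ))
    (hP : ∀ w : Fin n → ℝ, (∀ j, 0 < w j) → (∀ j, 0 < P w j) ∧ x (P w) = w) :
    ∀ w w' : Fin n → ℝ, (∀ j, 0 < w j) → (∀ j, 0 < w' j) →
      ∀ j, |Real.log (P w' j) - Real.log (P w j)| ≤
        ∑ i, |Real.log (w' i) - Real.log (w i)| := by
  intro w w' hw hw' j
  obtain ⟨hp, hxp⟩ := hP w hw
  obtain ⟨hq, hxq⟩ := hP w' hw'
  have h1 := one_sided n x hpos hgs hhom (P w) (P w') hp hq j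
  have h2 := one_sided n x hpos hgs hhom (P w') (P w) hq hp j
  rw [hxp, hxq] at h1 h2
  simp only [abs_sub_comm (Real.log (w _)) (Real.log (w' _))] at h2
  rw [abs_le]
  constructor <;> linarith
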